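/- Let ρ be a critical radius function on ℝ^n with constants C₀, N₀, and set τ₀ = 1 + C₀·2^{N₀/(N₀+1)}. If μ ∈ A₁^{ρ,loc}, then there is a constant C depending only on n, C₀, N₀ and [μ]_{A_1^{ρ,loc}} such that for every x₀ ∈ ℝ^n and every ball B contained in B(x₀, τ₀ρ(x₀)) one has (|B|^{−1}∫_B μ)·(essinf_B μ)^{−1} ≤ C; that is, the restriction of μ to B(x₀, τ₀ρ(x₀)) satisfies the A₁ condition on B(x₀, τ₀ρ(x₀)) uniformly in x₀. -/

import Mathlib

open MeasureTheory ENNReal Set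
noncomputable section

/-- `ℝ^n` with the Euclidean norm. -/
abbrev Rn (n : ℕ) := EuclideanSpace ℝ (Fin n)

/-- The cube of center `c` and side length `r`. -/
def cube {n : ℕ} (c : Rn n) (r : ℝ) : Set (Rn n) := {y | ∀ i, |y i - c i| ≤ r / 2}

/-- `ψ_θ(Q) = (1 + r_Q/ρ(x_Q))^θ` for the cube `Q` of center `c` and side length `r`. -/
def psi {n : ℕ} (ρ : Rn n → ℝ) (θ : ℝ) (c : Rn n) (r : ℝ) : ℝ := (1 + r / ρ c) ^ θ

/-- `ρ` is a critical radius function with constants `C₀, N₀`. -/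
def IsCriticalRadiusWith {n : ℕ} (ρ : Rn n → ℝ) (C₀ N₀ : ℝ) : Prop :=
  0 < C₀ ∧ 0 < N₀ ∧ (∀ x, 0 < ρ x) ∧ ∀ x y : Rn n,
    C₀⁻¹ * ρ x * (1 + ‖x - y‖ / ρ x) ^ (-N₀) ≤ ρ y ∧
    ρ y ≤ C₀ * ρ x * (1 + ‖x - y‖ / ρ x) ^ (N₀ / (N₀ + 1))

/-- `ρ` is a critical radius function. -/
def IsCriticalRadius {n : ℕ} (ρ : Rn n → ℝ) : Prop := ∃ C₀ N₀, IsCriticalRadiusWith ρ C₀ N₀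

/-- A weight: locally integrable and a.e. positive. -/
def IsWeight {n : ℕ} (w : Rn n → ℝ) : Prop :=
  LocallyIntegrable w (volume : Measure (Rn n)) ∧ ∀ᵐ x : Rn n, 0 < w x

/-- `w(S) = ∫_S w`. -/
def wMeas {n : ℕ} (w : Rn n → ℝ) (S : Set (Rn n)) : ℝ≥0∞ :=
  ∫⁻ x in S, ENNReal.ofReal (w x)

/-- Fractional maximal operator `M_α^{ρ,θ}` associated with the critical radius function `ρ`. -/
def fracMax (n : ℕ) (ρ : Rn n → ℝ) (θ α : ℝ) (f : Rn n → ℝ) (x : Rn n) : ℝ≥0∞ :=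
  ⨆ (c : Rn n) (r : ℝ) (_ : 0 < r) (_ : x ∈ cube c r),
    ENNReal.ofReal ((psi ρ θ c r * r ^ n) ^ (α / n - 1)) *
      ∫⁻ y in cube c r, ENNReal.ofReal |f y|

/-- The Lorentz `L^{p,1}(w)` norm. -/
def lorentzP1 {n : ℕ} (p : ℝ) (w : Rn n → ℝ) (f : Rn n → ℝ) : ℝ≥0∞ :=
  ENNReal.ofReal p * ∫⁻ y in Ioi (0 : ℝ), (wMeas w {x | y < |f x|}) ^ (1 / p)

/-- The weak `L^{q,∞}(w)` quasi-norm of an `ℝ≥0∞`-valued function. -/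
def weakNormE {n : ℕ} (q : ℝ) (w : Rn n → ℝ) (F : Rn n → ℝ≥0∞) : ℝ≥0∞ :=
  ⨆ (l : ℝ) (_ : 0 < l), ENNReal.ofReal l * (wMeas w {x | ENNReal.ofReal l < F x}) ^ (1 / q)

/-- The weak `L^{q,∞}(w)` quasi-norm of a real function, with `q = ∞` allowed
(in which case it is the `w`-essential supremum). -/
def weakNormR {n : ℕ} (q : ℝ≥0∞) (w : Rn n → ℝ) (f : Rn n → ℝ) : ℝ≥0∞ :=
  if q = ∞ then
    essSup (fun x => ENNReal.ofReal |f x|)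
      ((volume : Measure (Rn n)).withDensity fun x => ENNReal.ofReal (w x))
  else ⨆ (l : ℝ) (_ : 0 < l), ENNReal.ofReal l * (wMeas w {x | l < |f x|}) ^ (1 / q.toReal)

/-- The conjugate exponent `p' = p/(p-1)` (with `1' = ∞`), as an extended real number. -/
def conjE (p : ℝ) : ℝ≥0∞ := if p = 1 then ∞ else ENNReal.ofReal (p / (p - 1))

/-- The constant `[μ,ν]_{A_{p,q,α}^{ρ,θ,R}}`. -/
def ApqR {n : ℕ} (ρ : Rn n → ℝ) (θ α p q : ℝ) (μ ν : Rn n → ℝ) : ℝ≥0∞ :=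
  ⨆ (c : Rn n) (r : ℝ) (_ : 0 < r),
    (wMeas ν (cube c r)) ^ (1 / q) *
      weakNormR (conjE p) μ ((cube c r).indicator fun x => (μ x)⁻¹) *
      ENNReal.ofReal ((r ^ n * psi ρ θ c r) ^ (α / n - 1))

/-- The constant `‖μ,ν‖_{A_{p,q,α}^{ρ,θ,R}}`. -/
def normApqR {n : ℕ} (ρ : Rn n → ℝ) (θ α p q : ℝ) (μ ν : Rn n → ℝ) : ℝ≥0∞ :=
  ⨆ (c : Rn n) (r : ℝ) (_ : 0 < r),
    (wMeas ν (cube c r)) ^ (1 / q) *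
      ⨆ (P : Set (Rn n)) (_ : MeasurableSet P) (_ : 0 < wMeas μ P) (_ : wMeas μ P ≠ ∞),
        volume (P ∩ cube c r) * ENNReal.ofReal ((r ^ n * psi ρ θ c r) ^ (α / n - 1)) *
          (wMeas μ P) ^ (-(1 / p))

/-- The constant `[w]_{A_p^{ρ,σ}}` (for `1 < p < ∞`). -/
def ApC {n : ℕ} (ρ : Rn n → ℝ) (σ p : ℝ) (w : Rn n → ℝ) : ℝ≥0∞ :=
  ⨆ (c : Rn n) (r : ℝ) (_ : 0 < r),
    (ENNReal.ofReal (psi ρ σ c r))⁻¹ *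
      ((ENNReal.ofReal (r ^ n))⁻¹ * wMeas w (cube c r)) *
      ((ENNReal.ofReal (r ^ n))⁻¹ *
        ∫⁻ y in cube c r, ENNReal.ofReal (w y ^ (1 - p / (p - 1)))) ^ (p - 1)
/-- The heat semigroup `e^{tΔ}` on `ℝ^n`. -/
def heatSg (n : ℕ) (t : ℝ) (g : Rn n → ℝ) (x : Rn n) : ℝ :=
  ∫ y : Rn n, (4 * Real.pi * t) ^ (-(n : ℝ) / 2) * Real.exp (-‖x - y‖ ^ 2 / (4 * t)) * g y

/-- The `ϱ`-variation operator of the classical heat semigroup. -/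
def varHeat (n : ℕ) (ϱ : ℝ) (g : Rn n → ℝ) (x : Rn n) : ℝ≥0∞ :=
  ⨆ (t : ℕ → ℝ) (_ : StrictAnti t) (_ : ∀ j, 0 < t j)
      (_ : Filter.Tendsto t Filter.atTop (nhds 0)),
    (∑' j : ℕ, ENNReal.ofReal (|heatSg n (t j) g x - heatSg n (t (j + 1)) g x| ^ ϱ)) ^ (1 / ϱ)

/-- Muckenhoupt `A₁`. -/
def IsA1 {n : ℕ} (w : Rn n → ℝ) : Prop :=
  ∃ C > (0 : ℝ), ∀ (c : Rn n) (r : ℝ), 0 < r →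
    wMeas w (cube c r) ≤ ENNReal.ofReal C * ENNReal.ofReal (r ^ n) *
      essInf (fun x => ENNReal.ofReal (w x)) (volume.restrict (cube c r))

/-- Muckenhoupt `A_p`, `1 < p < ∞`. -/
def IsAp {n : ℕ} (p : ℝ) (w : Rn n → ℝ) : Prop :=
  ∃ C > (0 : ℝ), ∀ (c : Rn n) (r : ℝ), 0 < r →
    wMeas w (cube c r) *
      (∫⁻ y in cube c r, ENNReal.ofReal (w y ^ (1 - p / (p - 1)))) ^ (p - 1) ≤
      ENNReal.ofReal C * (ENNReal.ofReal (r ^ n)) ^ p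

/-- Muckenhoupt `A_∞ = ∪_{p ≥ 1} A_p`. -/
def IsAinfty {n : ℕ} (w : Rn n → ℝ) : Prop := IsA1 w ∨ ∃ p > (1 : ℝ), IsAp p w

/-- The class `A₁^{ρ,loc}`, with the `A₁` condition over balls `B(x,r)`, `r ≤ ρ(x)`. -/
def IsA1loc {n : ℕ} (ρ : Rn n → ℝ) (w : Rn n → ℝ) : Prop :=
  ∃ C > (0 : ℝ), ∀ (x : Rn n) (r : ℝ), 0 < r → r ≤ ρ x →
    wMeas w (Metric.ball x r) ≤ ENNReal.ofReal C * volume (Metric.ball x r) *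
      essInf (fun y => ENNReal.ofReal (w y)) (volume.restrict (Metric.ball x r))

/-- The class `A_p^{ρ,loc}` for `1 < p < ∞`. -/
def IsAploc {n : ℕ} (ρ : Rn n → ℝ) (p : ℝ) (w : Rn n → ℝ) : Prop :=
  ∃ C > (0 : ℝ), ∀ (x : Rn n) (r : ℝ), 0 < r → r ≤ ρ x →
    wMeas w (Metric.ball x r) *
      (∫⁻ y in Metric.ball x r, ENNReal.ofReal (w y ^ (1 - p / (p - 1)))) ^ (p - 1) ≤
      ENNReal.ofReal C * (volume (Metric.ball x r)) ^ p

/-- `A_∞^{ρ,loc} = ∪_{p ≥ 1} A_p^{ρ,loc}`. -/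
def IsAinfLoc {n : ℕ} (ρ : Rn n → ℝ) (w : Rn n → ℝ) : Prop :=
  IsA1loc ρ w ∨ ∃ p > (1 : ℝ), IsAploc ρ p w

/-- The class `A₁^{ρ,θ}`. -/
def IsA1rho {n : ℕ} (ρ : Rn n → ℝ) (θ : ℝ) (w : Rn n → ℝ) : Prop :=
  ∃ C > (0 : ℝ), ∀ (c : Rn n) (r : ℝ), 0 < r →
    wMeas w (cube c r) ≤ ENNReal.ofReal (C * (psi ρ θ c r * r ^ n)) *
      essInf (fun x => ENNReal.ofReal (w x)) (volume.restrict (cube c r))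

/-- The class `A_∞^ρ(μ)`. -/
def IsAinfRhoMu {n : ℕ} (ρ : Rn n → ℝ) (μ w : Rn n → ℝ) : Prop :=
  ∃ θ ≥ (0 : ℝ), ∃ ε > (0 : ℝ), ∃ C > (0 : ℝ), ∀ (c : Rn n) (r : ℝ), 0 < r →
    ∀ E ⊆ cube c r, MeasurableSet E →
      wMeas (fun x => w x * μ x) E ≤ ENNReal.ofReal (C * psi ρ θ c r) *
        (wMeas μ E / wMeas μ (cube c r)) ^ ε * wMeas (fun x => w x * μ x) (cube c r)

/-- The class `A_∞^ρ`. -/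
def IsAinfRho {n : ℕ} (ρ : Rn n → ℝ) (w : Rn n → ℝ) : Prop :=
  ∃ θ ≥ (0 : ℝ), ∃ δ > (0 : ℝ), ∃ C > (0 : ℝ), ∀ (c : Rn n) (r : ℝ), 0 < r →
    ∀ E ⊆ cube c r, MeasurableSet E →
      wMeas w E ≤ ENNReal.ofReal (C * psi ρ θ c r) *
        (volume E / ENNReal.ofReal (r ^ n)) ^ δ * wMeas w (cube c r)

/-- Membership in `RH_∞^{ρ,θ}` with constant `C`. -/
def IsRHinf {n : ℕ} (ρ : Rn n → ℝ) (θ : ℝ) (w : Rn n → ℝ) (C : ℝ) : Prop :=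
  ∀ (c : Rn n) (r : ℝ), 0 < r →
    essSup (fun x => ENNReal.ofReal (w x)) (volume.restrict (cube c r)) ≤
      ENNReal.ofReal (C * psi ρ θ c r) * ((ENNReal.ofReal (r ^ n))⁻¹ * wMeas w (cube c r))

/-- An `η`-sparse family of cubes, encoded by their (center, side length) data. -/
def IsSparse {n : ℕ} (η : ℝ) (S : Set (Rn n × ℝ)) : Prop :=
  S.Countable ∧ (∀ Q ∈ S, 0 < Q.2) ∧
  ∃ E : Rn n × ℝ → Set (Rn n),
    (∀ Q ∈ S, MeasurableSet (E Q) ∧ E Q ⊆ cube Q.1 Q.2 ∧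
      ENNReal.ofReal η * volume (cube Q.1 Q.2) ≤ volume (E Q)) ∧
    S.PairwiseDisjoint E

/-- The sparse operator `A_S^{ρ,N}`. -/
def sparseOp {n : ℕ} (ρ : Rn n → ℝ) (N : ℝ) (S : Set (Rn n × ℝ)) (f : Rn n → ℝ)
    (x : Rn n) : ℝ≥0∞ :=
  ∑' Q : S, (cube (Q : Rn n × ℝ).1 (Q : Rn n × ℝ).2).indicator
    (fun _ => (ENNReal.ofReal ((3 * (Q : Rn n × ℝ).2) ^ n))⁻¹ *
      (∫⁻ y in cube (Q : Rn n × ℝ).1 (3 * (Q : Rn n × ℝ).2), ENNReal.ofReal |f y|) *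
      (ENNReal.ofReal (psi ρ N (Q : Rn n × ℝ).1 (Q : Rn n × ℝ).2))⁻¹) x

/-- Comparability of the measures of two balls of the same radius, from the `A₁` condition on a
ball containing both. -/
lemma wMeas_ball_half_le {n : ℕ} {w : Rn n → ℝ} {K r : ℝ} (hr : 0 < r) {x y : Rn n}
    (hA : wMeas w (Metric.ball x r) ≤ ENNReal.ofReal K * volume (Metric.ball x r) *
      essInf (fun y => ENNReal.ofReal (w y)) (volume.restrict (Metric.ball x r)))
    (hxy : dist x y ≤ r / 2) :
    wMeas w (Metric.ball x (r / 2)) ≤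
      ENNReal.ofReal (K * 2 ^ n) * wMeas w (Metric.ball y (r / 2)) := by
  set m := essInf (fun y => ENNReal.ofReal (w y)) (volume.restrict (Metric.ball x r))
  have hvol : volume (Metric.ball x r) =
      ENNReal.ofReal (2 ^ n) * volume (Metric.ball y (r / 2)) := by
    have h := Measure.addHaar_ball_mul_of_pos (volume : Measure (Rn n)) x
      (zero_lt_two : (0 : ℝ) < 2) (r / 2)
    rw [mul_div_cancel₀ r two_ne_zero, finrank_euclideanSpace_fin] at h
    rw [h, Measure.addHaar_ball_center volume y]
  have hsub : Metric.ball y (r / 2) ⊆ Metric.ball x r :=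
    Metric.ball_subset_ball' (by rw [dist_comm]; linarith)
  have hmle : m * volume (Metric.ball y (r / 2)) ≤ wMeas w (Metric.ball y (r / 2)) := by
    rw [← setLIntegral_const]
    exact lintegral_mono_ae (ae_restrict_of_ae_restrict_of_subset hsub ae_essInf_le)
  calc wMeas w (Metric.ball x (r / 2))
      ≤ wMeas w (Metric.ball x r) :=
        lintegral_mono_set (Metric.ball_subset_ball (by linarith))
    _ ≤ ENNReal.ofReal K * volume (Metric.ball x r) * m := hA
    _ = ENNReal.ofReal (K * 2 ^ n) * (m * volume (Metric.ball y (r / 2))) := by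
        rw [hvol, ENNReal.ofReal_mul' (by positivity)]; ring
    _ ≤ _ := by gcongr

/-- If a quantity on points of a convex set grows at most by a factor `A` between points at
distance at most `d`, then it grows at most by `A ^ k` between points at distance at most
`k * d`. -/
lemma Convex.le_pow_mul_of_dist_le {E : Type*} [NormedAddCommGroup E] [NormedSpace ℝ E]
    {S : Set E} (hS : Convex ℝ S) {f : E → ℝ≥0∞} {A : ℝ≥0∞} {d : ℝ}
    (hf : ∀ x ∈ S, ∀ y ∈ S, dist x y ≤ d → f x ≤ A * f y) (k : ℕ) :
    ∀ x ∈ S, ∀ y ∈ S, dist x y ≤ k * d → f x ≤ A ^ k * f y := by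
  induction k with
  | zero =>
    intro x _ y _ h
    have : x = y := dist_le_zero.mp (by simpa using h)
    simp [this]
  | succ k ih =>
    intro x hx y hy h
    have hk : (0 : ℝ) < k + 1 := by positivity
    push_cast at h
    set t : ℝ := 1 / (k + 1) with ht
    have ht0 : 0 ≤ t := by positivity
    have ht1 : t ≤ 1 := by rw [ht, div_le_one hk]; linarith [k.cast_nonneg (α := ℝ)]
    have hz : AffineMap.lineMap x y t ∈ S := hS.lineMap_mem hx hy ⟨ht0, ht1⟩
    have h1 : dist x (AffineMap.lineMap x y t) ≤ d := by
      rw [dist_left_lineMap, Real.norm_of_nonneg ht0, ht, one_div_mul_eq_div, div_le_iff₀ hk]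
      linarith
    have h2 : dist (AffineMap.lineMap x y t) y ≤ k * d := by
      rw [dist_lineMap_right, Real.norm_of_nonneg (by linarith)]
      have : 1 - t = k / (k + 1) := by rw [ht]; field_simp; ring
      rw [this, div_mul_eq_mul_div, div_le_iff₀ hk]
      nlinarith [k.cast_nonneg (α := ℝ)]
    calc f x ≤ A * f (AffineMap.lineMap x y t) := hf x hx _ hz h1
      _ ≤ A * (A ^ k * f y) := by gcongr; exact ih _ hz y hy h2
      _ = A ^ (k + 1) * f y := by ring

/-- On a ball of radius comparable to `ρ x₀`, the critical radius is bounded below. -/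
lemma IsCriticalRadiusWith.le_of_dist_le {n : ℕ} {ρ : Rn n → ℝ} {C₀ N₀ τ : ℝ}
    (hρ : IsCriticalRadiusWith ρ C₀ N₀) {x z : Rn n}
    (hz : dist z x ≤ τ * ρ x) :
    C₀⁻¹ * (1 + τ) ^ (-N₀) * ρ x ≤ ρ z := by
  obtain ⟨hC, hN, hpos, h⟩ := hρ
  have hx := hpos x
  have hle : ‖x - z‖ / ρ x ≤ τ := by
    rwa [div_le_iff₀ hx, ← dist_eq_norm, dist_comm]
  have hq : 0 ≤ ‖x - z‖ / ρ x := by positivity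
  calc C₀⁻¹ * (1 + τ) ^ (-N₀) * ρ x = C₀⁻¹ * ρ x * (1 + τ) ^ (-N₀) := by ring
    _ ≤ C₀⁻¹ * ρ x * (1 + ‖x - z‖ / ρ x) ^ (-N₀) := by
        gcongr ?_ * ?_
        exact Real.rpow_le_rpow_of_nonpos (by linarith) (by linarith) (by linarith)
    _ ≤ ρ z := (h x z).1

/-- A set covered by finitely many balls of radius `r`, on which the measures of `w` are mutually
comparable and the `A₁` condition holds, satisfies an `A₁`-type bound. -/
lemma ae_wMeas_le_of_cover {n : ℕ} {ι : Type*} {w : Rn n → ℝ} {T : Finset ι} {z : ι → Rn n}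
    {S : Set (Rn n)} {r : ℝ} {K A V : ℝ≥0∞}
    (hcov : S ⊆ ⋃ i ∈ T, Metric.ball (z i) r)
    (hV : ∀ i ∈ T, volume (Metric.ball (z i) r) ≤ V)
    (hA : ∀ i ∈ T, ∀ j ∈ T,
      wMeas w (Metric.ball (z i) r) ≤ A * wMeas w (Metric.ball (z j) r))
    (hK : ∀ i ∈ T, wMeas w (Metric.ball (z i) r) ≤ K * volume (Metric.ball (z i) r) *
      essInf (fun y => ENNReal.ofReal (w y)) (volume.restrict (Metric.ball (z i) r))) :
    ∀ᵐ x ∂volume.restrict S, wMeas w S ≤ T.card * A * K * V * ENNReal.ofReal (w x) := by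
  have hsum : ∀ j ∈ T, wMeas w S ≤ T.card * (A * wMeas w (Metric.ball (z j) r)) := by
    intro j hj
    calc wMeas w S ≤ wMeas w (⋃ i ∈ T, Metric.ball (z i) r) := lintegral_mono_set hcov
      _ ≤ ∑ i ∈ T, wMeas w (Metric.ball (z i) r) := by
          unfold wMeas
          simp_rw [← withDensity_apply' (μ := volume) (fun x => ENNReal.ofReal (w x))]
          exact measure_biUnion_finset_le T _
      _ ≤ ∑ _i ∈ T, A * wMeas w (Metric.ball (z j) r) := Finset.sum_le_sum fun i hi => hA i hi j hj
      _ = _ := by rw [Finset.sum_const, nsmul_eq_mul]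
  refine ae_restrict_of_ae_restrict_of_subset hcov ?_
  rw [ae_restrict_biUnion_finset_iff]
  intro j hj
  filter_upwards [ae_essInf_le (f := fun y => ENNReal.ofReal (w y))
    (μ := volume.restrict (Metric.ball (z j) r))] with x hx
  calc wMeas w S ≤ T.card * (A * wMeas w (Metric.ball (z j) r)) := hsum j hj
    _ ≤ T.card * (A * (K * V * ENNReal.ofReal (w x))) := by
        gcongr
        refine (hK j hj).trans ?_
        gcongr
        exact hV j hj
    _ = _ := by ring

/-- If `μ ∈ A₁^{ρ,loc}` with constant `K`, then the restriction of `μ` to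
any critical ball `B(x₀, τ₀ρ(x₀))`, `τ₀ = 1 + C₀·2^{N₀/(N₀+1)}`, satisfies the `A₁`
condition there, uniformly in `x₀`, with a constant depending only on `n`, `C₀`, `N₀`
and `K`. -/
theorem statement15 (n : ℕ) (C₀ N₀ K : ℝ) (hK : 0 < K) :
    ∃ C : ℝ, 0 < C ∧
      ∀ (ρ : Rn n → ℝ), IsCriticalRadiusWith ρ C₀ N₀ →
      ∀ μ : Rn n → ℝ, IsWeight μ →
      (∀ (x : Rn n) (r : ℝ), 0 < r → r ≤ ρ x →
        wMeas μ (Metric.ball x r) ≤ ENNReal.ofReal K * volume (Metric.ball x r) *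
          essInf (fun y => ENNReal.ofReal (μ y)) (volume.restrict (Metric.ball x r))) →
      ∀ (x₀ y : Rn n) (s : ℝ), 0 < s →
        Metric.ball y s ⊆ Metric.ball x₀ ((1 + C₀ * (2 : ℝ) ^ (N₀ / (N₀ + 1))) * ρ x₀) →
        wMeas μ (Metric.ball y s) ≤ ENNReal.ofReal C * volume (Metric.ball y s) *
          essInf (fun z => ENNReal.ofReal (μ z)) (volume.restrict (Metric.ball y s)) := by
  rcases le_or_gt C₀ 0 with hC | hC
  · exact ⟨1, one_pos, fun ρ hρ => absurd hρ.1 hC.not_gt⟩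
  set τ : ℝ := 1 + C₀ * (2 : ℝ) ^ (N₀ / (N₀ + 1)) with hτ
  have hτ0 : 0 < τ := by positivity
  set κ : ℝ := C₀⁻¹ * (1 + τ) ^ (-N₀) with hκ
  have hκ0 : 0 < κ := by positivity
  obtain ⟨T', hT's, hT'f, hT'c⟩ :=
    (isCompact_closedBall (0 : Rn n) τ).finite_cover_balls (half_pos hκ0)
  lift T' to Finset (Rn n) using hT'f with T
  set N : ℕ := ⌈4 * τ / κ⌉₊
  set L : ℝ := (T.card : ℝ) * (K * 2 ^ n) ^ N * K with hL
  refine ⟨L + K, by positivity, fun ρ hρ μ _ hμ x₀ y s hs hsub => ?_⟩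
  have hx := hρ.2.2.1 x₀
  set r : ℝ := κ * ρ x₀ with hr
  have hr0 : 0 < r := by positivity
  have hρr : ∀ z ∈ Metric.closedBall x₀ (τ * ρ x₀), r ≤ ρ z := fun z hz => hρ.le_of_dist_le hz
  rcases le_or_gt s r with hsr | hsr
  · have hy : y ∈ Metric.closedBall x₀ (τ * ρ x₀) :=
      Metric.ball_subset_closedBall (hsub (Metric.mem_ball_self hs))
    refine (hμ y s hs (hsr.trans (hρr y hy))).trans ?_
    gcongr
    exact le_add_of_nonneg_left (by positivity)
  have hTmem : ∀ t ∈ T, x₀ + ρ x₀ • t ∈ Metric.closedBall x₀ (τ * ρ x₀) := by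
    intro t ht
    have := hT's ht
    rw [mem_closedBall_zero_iff] at this
    rw [mem_closedBall_iff_norm, add_sub_cancel_left, norm_smul, Real.norm_of_nonneg hx.le, mul_comm]
    gcongr
  have hcov : Metric.ball x₀ (τ * ρ x₀) ⊆ ⋃ t ∈ T, Metric.ball (x₀ + ρ x₀ • t) (r / 2) := by
    intro x hxm
    have hu : (ρ x₀)⁻¹ • (x - x₀) ∈ Metric.closedBall (0 : Rn n) τ := by
      rw [mem_ball_iff_norm] at hxm
      rw [mem_closedBall_zero_iff, norm_smul, norm_inv, Real.norm_of_nonneg hx.le,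
        inv_mul_le_iff₀ hx, mul_comm]
      exact hxm.le
    obtain ⟨t, ht, hut⟩ := mem_iUnion₂.mp (hT'c hu)
    refine mem_iUnion₂.mpr ⟨t, ht, ?_⟩
    rw [mem_ball_iff_norm] at hut ⊢
    have : x - (x₀ + ρ x₀ • t) = ρ x₀ • ((ρ x₀)⁻¹ • (x - x₀) - t) := by
      rw [smul_sub, smul_inv_smul₀ hx.ne']; abel
    rw [this, norm_smul, Real.norm_of_nonneg hx.le]
    calc ρ x₀ * _ < ρ x₀ * (κ / 2) := by gcongr
      _ = r / 2 := by rw [hr]; ring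
  have hchain := (convex_closedBall x₀ (τ * ρ x₀)).le_pow_mul_of_dist_le
    (f := fun z => wMeas μ (Metric.ball z (r / 2))) (A := ENNReal.ofReal (K * 2 ^ n)) (d := r / 2)
    (fun a ha b _ hab => wMeas_ball_half_le hr0 (hμ a r hr0 (hρr a ha)) hab) N
  have hNd : ∀ a ∈ Metric.closedBall x₀ (τ * ρ x₀), ∀ b ∈ Metric.closedBall x₀ (τ * ρ x₀),
      dist a b ≤ N * (r / 2) := by
    intro a ha b hb
    rw [Metric.mem_closedBall] at ha hb
    have h1 := dist_triangle_right a b x₀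
    have h2 : 4 * τ ≤ N * κ := (div_le_iff₀ hκ0).mp (Nat.le_ceil _)
    have h3 := mul_le_mul_of_nonneg_right h2 hx.le
    rw [hr]
    linarith
  have hae := ae_wMeas_le_of_cover (w := μ) (V := volume (Metric.ball (0 : Rn n) (r / 2))) hcov
    (fun t _ => (Measure.addHaar_ball_center volume _ _).le)
    (fun i hi j hj => hchain _ (hTmem i hi) _ (hTmem j hj) (hNd _ (hTmem i hi) _ (hTmem j hj)))
    (fun i hi => hμ _ _ (half_pos hr0) ((half_le_self hr0.le).trans (hρr _ (hTmem i hi))))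
  have hcoef : (T.card : ℝ≥0∞) * ENNReal.ofReal (K * 2 ^ n) ^ N * ENNReal.ofReal K *
      volume (Metric.ball (0 : Rn n) (r / 2)) ≤
      ENNReal.ofReal (L + K) * volume (Metric.ball y s) := by
    have : (T.card : ℝ≥0∞) * ENNReal.ofReal (K * 2 ^ n) ^ N * ENNReal.ofReal K =
        ENNReal.ofReal L := by
      rw [hL, ENNReal.ofReal_mul (q := K) (by positivity),
        ENNReal.ofReal_mul (p := (T.card : ℝ)) (by positivity),
        ENNReal.ofReal_natCast, ENNReal.ofReal_pow (by positivity)]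
    rw [this, ← Measure.addHaar_ball_center volume y (r / 2)]
    gcongr
    · linarith
    · linarith
  have hc0 : ENNReal.ofReal (L + K) * volume (Metric.ball y s) ≠ 0 :=
    mul_ne_zero (ENNReal.ofReal_pos.mpr (by positivity)).ne' (Metric.measure_ball_pos _ y hs).ne'
  have hct : ENNReal.ofReal (L + K) * volume (Metric.ball y s) ≠ ∞ :=
    ENNReal.mul_ne_top ENNReal.ofReal_ne_top measure_ball_lt_top.ne
  rw [← ENNReal.div_le_iff' hc0 hct]
  refine le_essInf_of_ae_le _ ?_
  filter_upwards [ae_restrict_of_ae_restrict_of_subset hsub hae] with x hxle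
  rw [ENNReal.div_le_iff' hc0 hct]
  calc wMeas μ (Metric.ball y s) ≤ wMeas μ (Metric.ball x₀ (τ * ρ x₀)) := lintegral_mono_set hsub
    _ ≤ _ := hxle
    _ ≤ _ := by gcongr
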